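/- arXiv:2411.01482 — 3 statements merged into one kernel-verified Lean document; each statement's English description precedes it below -/
import Mathlib

section
/- Let d ≥ 1, let K ⊂ ℝ^d be an open convex body, let γ ∈ (0, 1/2] be such that B(o,γ) ⊂ K ⊂ B(o,1/2), and let δ ∈ (0, 1/2] be such that the origin o lies in K_δ. Set η = √3·γ/d and ζ = (1/(4γ²))·(2/ω_d)^{1/d}. Then (1 − (ζ/γ)·(δ|K|)^{1/d})·K ⊆ K_δ ⊆ (1 − 2η·δ|K|)·K. -/
open MeasureTheory Metric Bornology
open scoped InnerProductSpace Pointwise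

noncomputable def halfspaceDepth {d : ℕ} (K : Set (EuclideanSpace ℝ (Fin d)))
    (q : EuclideanSpace ℝ (Fin d)) : ℝ :=
  ⨅ v : {v : EuclideanSpace ℝ (Fin d) // ‖v‖ = 1},
    (volume {z : EuclideanSpace ℝ (Fin d) | z ∈ K ∧ 0 ≤ ⟪(v : EuclideanSpace ℝ (Fin d)), z - q⟫_ℝ}).toReal
      / (volume K).toReal

def depthRegion {d : ℕ} (K : Set (EuclideanSpace ℝ (Fin d))) (δ : ℝ) :
    Set (EuclideanSpace ℝ (Fin d)) :=
  {q | δ ≤ halfspaceDepth K q}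

noncomputable def hilbertDist {d : ℕ} (K : Set (EuclideanSpace ℝ (Fin d)))
    (p q : EuclideanSpace ℝ (Fin d)) : ℝ :=
  sInf {r : ℝ | (p = q ∧ r = 0) ∨
    ∃ a b : EuclideanSpace ℝ (Fin d), a ∈ frontier K ∧ b ∈ frontier K ∧
      (∃ t : ℝ, t < 0 ∧ a = p + t • (q - p)) ∧
      (∃ s : ℝ, 1 < s ∧ b = p + s • (q - p)) ∧
      r = (1 / 2) * Real.log ((‖q - a‖ * ‖p - b‖) / (‖p - a‖ * ‖q - b‖))}

def hilbertBall {d : ℕ} (K : Set (EuclideanSpace ℝ (Fin d)))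
    (x : EuclideanSpace ℝ (Fin d)) (r : ℝ) : Set (EuclideanSpace ℝ (Fin d)) :=
  {y | 0 < r ∧ y ∈ K ∧ hilbertDist K x y < r}

noncomputable def omegaBall (d : ℕ) : ℝ :=
  (volume (Metric.ball (0 : EuclideanSpace ℝ (Fin d)) 1)).toReal

def dilate {d : ℕ} (lam : ℝ) (K : Set (EuclideanSpace ℝ (Fin d))) :
    Set (EuclideanSpace ℝ (Fin d)) :=
  {y | 0 < lam ∧ y ∈ lam • K}


/-- A subset of the ball of radius `1 / 2` lying in a slab of width `w` has volume at most `w`. -/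
theorem volume_le_of_subset_slab {d : ℕ} (hd : 1 ≤ d) {S : Set (EuclideanSpace ℝ (Fin d))}
    (hS : S ⊆ ball (0 : EuclideanSpace ℝ (Fin d)) (1 / 2))
    {v : EuclideanSpace ℝ (Fin d)} (hv : ‖v‖ = 1) {a w : ℝ}
    (hslab : ∀ z ∈ S, a ≤ ⟪v, z⟫_ℝ ∧ ⟪v, z⟫_ℝ ≤ a + w) :
    volume S ≤ ENNReal.ofReal w := by
  classical
  let i₀ : Fin d := ⟨0, hd⟩
  obtain ⟨b, hb⟩ := Orthonormal.exists_orthonormalBasis_extension_of_card_eq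
    (𝕜 := ℝ) (ι := Fin d) (by simp) (v := fun _ : Fin d => v) (s := {i₀})
    (by
      constructor
      · intro i
        simpa using hv
      · intro i j hij
        exact absurd (Subsingleton.elim i j) hij)
  have hb₀ : b i₀ = v := hb i₀ rfl
  let lo : Fin d → ℝ := fun i => if i = i₀ then a else -(1 / 2)
  let up : Fin d → ℝ := fun i => if i = i₀ then a + w else 1 / 2
  have hmp := (EuclideanSpace.volume_preserving_symm_measurableEquiv_toLp (Fin d)).comp
    b.measurePreserving_repr
  calc volume S
      ≤ volume (((MeasurableEquiv.toLp 2 (Fin d → ℝ)).symm ∘ b.repr) ⁻¹' Set.Icc lo up) := by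
        refine measure_mono fun z hz => ?_
        have key : ∀ i, lo i ≤ b.repr z i ∧ b.repr z i ≤ up i := by
          intro i
          rw [b.repr_apply_apply]
          by_cases hi : i = i₀
          · simpa [lo, up, hi, hb₀] using hslab z hz
          · have hz' : ‖z‖ < 1 / 2 := by simpa using hS hz
            have h := (abs_real_inner_le_norm (b i) z).trans_eq
              (by rw [b.orthonormal.1 i, one_mul])
            have := abs_le.1 (h.trans hz'.le)
            simpa [lo, up, hi] using this
        exact ⟨fun i => (key i).1, fun i => (key i).2⟩
    _ = volume (Set.Icc lo up) := hmp.measure_preimage measurableSet_Icc.nullMeasurableSet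
    _ = ENNReal.ofReal w := by
        rw [Real.volume_Icc_pi, Finset.prod_eq_single i₀]
        · simp [lo, up]
        · intro i _ hi
          simp [lo, up, hi]
          norm_num
        · simp

theorem volume_ball_le_two_mul_volume_halfBall {d : ℕ} (q v : EuclideanSpace ℝ (Fin d)) (r : ℝ) :
    volume (ball q r) ≤ 2 * volume {z | z ∈ ball q r ∧ 0 ≤ ⟪v, z - q⟫_ℝ} := by
  set H := {z | z ∈ ball q r ∧ 0 ≤ ⟪v, z - q⟫_ℝ} with hH
  have hHm : MeasurableSet H :=
    measurableSet_ball.inter (measurableSet_le measurable_const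
      (by fun_prop : Measurable fun z => ⟪v, z - q⟫_ℝ))
  have hrefl : volume ((fun z => (q + q) - z) ⁻¹' H) = volume H :=
    (Measure.measurePreserving_sub_left volume (q + q)).measure_preimage hHm.nullMeasurableSet
  calc volume (ball q r) ≤ volume (H ∪ (fun z => (q + q) - z) ⁻¹' H) := by
        refine measure_mono fun z hz => ?_
        have hsub : q + q - z - q = -(z - q) := by abel
        rcases le_total 0 ⟪v, z - q⟫_ℝ with h | h
        · exact Or.inl ⟨hz, h⟩
        · refine Or.inr ⟨?_, ?_⟩
          · rw [mem_ball, dist_eq_norm, hsub, norm_neg, ← dist_eq_norm]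
            exact hz
          · rw [hsub, inner_neg_right]
            linarith
    _ ≤ volume H + volume ((fun z => (q + q) - z) ⁻¹' H) := measure_union_le _ _
    _ = 2 * volume H := by rw [hrefl, two_mul]

theorem le_halfspaceDepth_of_ball_subset {d : ℕ} (hd : 1 ≤ d)
    {K : Set (EuclideanSpace ℝ (Fin d))} (hKbdd : IsBounded K) (hKpos : 0 < (volume K).toReal)
    {q : EuclideanSpace ℝ (Fin d)} {r : ℝ} (hr : 0 ≤ r) (hball : ball q r ⊆ K) {δ : ℝ}
    (hδ : 2 * (δ * (volume K).toReal) ≤ r ^ d * omegaBall d) :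
    δ ≤ halfspaceDepth K q := by
  have : Nonempty (Fin d) := ⟨⟨0, hd⟩⟩
  obtain ⟨e, he⟩ := exists_norm_eq (EuclideanSpace ℝ (Fin d)) zero_le_one
  have : Nonempty {v : EuclideanSpace ℝ (Fin d) // ‖v‖ = 1} := ⟨⟨e, he⟩⟩
  refine le_ciInf fun v => ?_
  rw [le_div_iff₀ hKpos]
  have hfin : volume {z | z ∈ K ∧ 0 ≤ ⟪(v : EuclideanSpace ℝ (Fin d)), z - q⟫_ℝ} ≠ ⊤ :=
    ((measure_mono fun _ hz => hz.1).trans_lt hKbdd.measure_lt_top).ne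
  have h := (volume_ball_le_two_mul_volume_halfBall q v r).trans
    (mul_le_mul_right (measure_mono (fun z hz => ⟨hball hz.1, hz.2⟩ :
      _ ⊆ {z | z ∈ K ∧ 0 ≤ ⟪(v : EuclideanSpace ℝ (Fin d)), z - q⟫_ℝ})) 2)
  have h' := ENNReal.toReal_mono (ENNReal.mul_ne_top (by simp) hfin) h
  rw [Measure.addHaar_ball _ _ hr, ENNReal.toReal_mul, ENNReal.toReal_mul,
    ENNReal.toReal_ofReal (by positivity), finrank_euclideanSpace_fin] at h'
  change r ^ d * omegaBall d ≤ _ at h'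
  norm_num at h'
  linarith

theorem Convex.ball_smul_subset {d : ℕ} {K : Set (EuclideanSpace ℝ (Fin d))} (hK : Convex ℝ K)
    {γ s : ℝ} (hγK : ball (0 : EuclideanSpace ℝ (Fin d)) γ ⊆ K) (hs : 0 < s) (hs1 : s ≤ 1)
    {k : EuclideanSpace ℝ (Fin d)} (hk : k ∈ K) :
    ball ((1 - s) • k) (s * γ) ⊆ K := by
  intro z hz
  rw [mem_ball, dist_eq_norm] at hz
  have hy : s⁻¹ • (z - (1 - s) • k) ∈ K := by
    apply hγK
    rw [mem_ball_zero_iff, norm_smul, norm_inv, Real.norm_of_nonneg hs.le,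
      inv_mul_lt_iff₀ hs]
    exact hz
  have h := hK hk hy (sub_nonneg.2 hs1) hs.le (by ring)
  rwa [smul_inv_smul₀ hs.ne', add_sub_cancel] at h

/-- A positive dilate of an open convex set containing the origin is separated by a unit normal
from every point outside it. -/
theorem exists_unit_normal_of_notMem_smul {d : ℕ} {K : Set (EuclideanSpace ℝ (Fin d))}
    (hKopen : IsOpen K) (hKconv : Convex ℝ K) (h0 : (0 : EuclideanSpace ℝ (Fin d)) ∈ K)
    {μ : ℝ} (hμ : 0 < μ) {q : EuclideanSpace ℝ (Fin d)} (hq : q ∉ μ • K) :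
    ∃ v : EuclideanSpace ℝ (Fin d), ‖v‖ = 1 ∧ ∀ z ∈ K, μ * ⟪v, z⟫_ℝ < ⟪v, q⟫_ℝ := by
  obtain ⟨f, hf⟩ := geometric_hahn_banach_open_point (hKconv.smul μ)
    (hKopen.smul₀ hμ.ne') hq
  obtain ⟨u, rfl⟩ := (InnerProductSpace.toDual ℝ (EuclideanSpace ℝ (Fin d))).surjective f
  simp only [InnerProductSpace.toDual_apply_apply] at hf
  have hu : u ≠ 0 := by
    rintro rfl
    simpa using hf 0 ⟨0, h0, smul_zero _⟩
  have hupos : 0 < ‖u‖ := norm_pos_iff.2 hu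
  refine ⟨‖u‖⁻¹ • u, norm_smul_inv_norm hu, fun z hz => ?_⟩
  have h := hf (μ • z) ⟨z, hz, rfl⟩
  rw [inner_smul_right] at h
  rw [real_inner_smul_left, real_inner_smul_left, mul_left_comm]
  gcongr

/-- The cap of a convex set beyond a point outside its `μ`-dilate has width at most
`(1 - μ) / 2`, which bounds the depth of that point. -/
theorem halfspaceDepth_mul_volume_le {d : ℕ} (hd : 1 ≤ d) {K : Set (EuclideanSpace ℝ (Fin d))}
    (hKopen : IsOpen K) (hKconv : Convex ℝ K) (h0 : (0 : EuclideanSpace ℝ (Fin d)) ∈ K)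
    (hK12 : K ⊆ ball (0 : EuclideanSpace ℝ (Fin d)) (1 / 2)) (hKpos : 0 < (volume K).toReal)
    {μ : ℝ} (hμ : 0 < μ) (hμ1 : μ ≤ 1) {q : EuclideanSpace ℝ (Fin d)} (hq : q ∉ μ • K) :
    halfspaceDepth K q * (volume K).toReal ≤ (1 - μ) / 2 := by
  obtain ⟨v, hv, hsep⟩ := exists_unit_normal_of_notMem_smul hKopen hKconv h0 hμ hq
  have hcap : volume {z | z ∈ K ∧ 0 ≤ ⟪v, z - q⟫_ℝ} ≤ ENNReal.ofReal ((1 - μ) / 2) := by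
    refine volume_le_of_subset_slab hd (fun z hz => hK12 hz.1) hv (a := ⟪v, q⟫_ℝ) ?_
    rintro z ⟨hzK, hz⟩
    rw [inner_sub_right] at hz
    have hz' : ‖z‖ < 1 / 2 := by simpa using hK12 hzK
    have hvz : ⟪v, z⟫_ℝ ≤ 1 / 2 := by
      have := real_inner_le_norm v z
      rw [hv, one_mul] at this
      linarith
    have := hsep z hzK
    exact ⟨by linarith, by nlinarith⟩
  have hdepth : halfspaceDepth K q ≤
      (volume {z | z ∈ K ∧ 0 ≤ ⟪v, z - q⟫_ℝ}).toReal / (volume K).toReal :=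
    ciInf_le (f := fun v : {v : EuclideanSpace ℝ (Fin d) // ‖v‖ = 1} =>
      (volume {z | z ∈ K ∧ 0 ≤ ⟪(v : EuclideanSpace ℝ (Fin d)), z - q⟫_ℝ}).toReal /
        (volume K).toReal)
      ⟨0, by rintro _ ⟨w, rfl⟩; positivity⟩ ⟨v, hv⟩
  exact ((le_div_iff₀ hKpos).1 hdepth).trans
    (ENNReal.toReal_le_of_le_ofReal (by linarith) hcap)

theorem volume_toReal_le_one {d : ℕ} (hd : 1 ≤ d) {K : Set (EuclideanSpace ℝ (Fin d))}
    (hK12 : K ⊆ ball (0 : EuclideanSpace ℝ (Fin d)) (1 / 2)) : (volume K).toReal ≤ 1 := by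
  have : Nonempty (Fin d) := ⟨⟨0, hd⟩⟩
  obtain ⟨e, he⟩ := exists_norm_eq (EuclideanSpace ℝ (Fin d)) zero_le_one
  refine ENNReal.toReal_le_of_le_ofReal zero_le_one
    (volume_le_of_subset_slab hd hK12 he (a := -(1 / 2)) fun z hz => ?_)
  have hz' : ‖z‖ < 1 / 2 := by simpa using hK12 hz
  have h := abs_real_inner_le_norm e z
  rw [he, one_mul] at h
  have := abs_le.1 (h.trans hz'.le)
  exact ⟨this.1, by linarith [this.2]⟩

theorem stmt1 {d : ℕ} (hd : 1 ≤ d) (K : Set (EuclideanSpace ℝ (Fin d)))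
    (hKne : K.Nonempty) (hKopen : IsOpen K) (hKbdd : IsBounded K) (hKconv : Convex ℝ K)
    (γ : ℝ) (hγ0 : 0 < γ) (hγ1 : γ ≤ 1 / 2)
    (hγK : ball (0 : EuclideanSpace ℝ (Fin d)) γ ⊆ K)
    (hK12 : K ⊆ ball (0 : EuclideanSpace ℝ (Fin d)) (1 / 2))
    (δ : ℝ) (hδ0 : 0 < δ) (hδ1 : δ ≤ 1 / 2)
    (ho : (0 : EuclideanSpace ℝ (Fin d)) ∈ depthRegion K δ)
    (η ζ : ℝ) (hη : η = Real.sqrt 3 * γ / d)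
    (hζ : ζ = (1 / (4 * γ ^ 2)) * (2 / omegaBall d) ^ ((1 : ℝ) / d)) :
    dilate (1 - (ζ / γ) * (δ * (volume K).toReal) ^ ((1 : ℝ) / d)) K ⊆ depthRegion K δ ∧
    depthRegion K δ ⊆ dilate (1 - 2 * η * (δ * (volume K).toReal)) K := by
  have hω : 0 < omegaBall d :=
    ENNReal.toReal_pos (measure_ball_pos volume _ one_pos).ne' measure_ball_lt_top.ne
  have hKpos : 0 < (volume K).toReal :=
    ENNReal.toReal_pos (hKopen.measure_pos volume hKne).ne' hKbdd.measure_lt_top.ne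
  have hd0 : d ≠ 0 := by omega
  have hd1 : (1 : ℝ) ≤ d := by exact_mod_cast hd
  set V := (volume K).toReal with hV
  have hδV : 0 < δ * V := mul_pos hδ0 hKpos
  constructor
  · rintro _ ⟨hpos, k, hk, rfl⟩
    have hζ0 : 0 < ζ := by rw [hζ]; positivity
    set s := ζ / γ * (δ * V) ^ ((1 : ℝ) / d) with hs
    have hs0 : 0 < s := by positivity
    refine le_halfspaceDepth_of_ball_subset hd hKbdd hKpos (by positivity)
      (hKconv.ball_smul_subset hγK hs0 (by linarith) hk) ?_
    have hroot : ∀ x : ℝ, 0 ≤ x → (x ^ ((1 : ℝ) / d)) ^ d = x := fun x hx => by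
      rw [one_div, Real.rpow_inv_natCast_pow hx hd0]
    have hsγ : s * γ = 1 / (4 * γ ^ 2) * (2 / omegaBall d) ^ ((1 : ℝ) / d) *
        (δ * V) ^ ((1 : ℝ) / d) := by
      rw [hs, hζ]
      field_simp
    rw [hsγ, mul_pow, mul_pow, hroot _ (by positivity), hroot _ hδV.le]
    have hc : 1 ≤ (1 / (4 * γ ^ 2)) ^ d :=
      one_le_pow₀ (by rw [le_div_iff₀ (by positivity)]; nlinarith)
    calc 2 * (δ * V) ≤ (1 / (4 * γ ^ 2)) ^ d * (2 * (δ * V)) :=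
          le_mul_of_one_le_left (by positivity) hc
      _ = _ := by field_simp
  · intro q hq
    have hη0 : 0 ≤ η := by rw [hη]; positivity
    have hsqrt : Real.sqrt 3 < 2 := by
      rw [Real.sqrt_lt' two_pos]
      norm_num
    have hη1 : η < 1 := by
      rw [hη, div_lt_one (by positivity)]
      nlinarith [Real.sqrt_nonneg 3]
    have hV1 : V ≤ 1 := volume_toReal_le_one hd hK12
    have hμ : 0 < 1 - 2 * η * (δ * V) := by nlinarith
    refine ⟨hμ, ?_⟩
    by_contra hnot
    have hle := halfspaceDepth_mul_volume_le hd hKopen hKconv (hγK (mem_ball_self hγ0)) hK12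
      hKpos hμ (by nlinarith) hnot
    have hq' : δ * V ≤ halfspaceDepth K q * V := mul_le_mul_of_nonneg_right hq hKpos.le
    nlinarith
end

section
/- Let d ≥ 1, let K ⊂ ℝ^d be an open convex body with K ⊂ B(o,1/2), let δ ∈ (0,1/2], let ε ∈ (0,1), and let z ∈ K_δ. Then B_K(z, ε·δ·|K|/2) ⊆ K_{(1−ε)δ}. -/
open MeasureTheory Metric Bornology
open scoped InnerProductSpace Pointwise

/-- The part of a subset of the ball of radius `1/2` between two parallel hyperplanes at distance
`s` has volume at most `s`. -/
lemma volume_slab_le {d : ℕ} (hd : 1 ≤ d) {K : Set (EuclideanSpace ℝ (Fin d))}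
    (hK12 : K ⊆ ball (0 : EuclideanSpace ℝ (Fin d)) (1 / 2))
    {v : EuclideanSpace ℝ (Fin d)} (hv : ‖v‖ = 1) (c s : ℝ) :
    volume {x | x ∈ K ∧ ⟪v, x⟫_ℝ ∈ Set.Icc c (c + s)} ≤ ENNReal.ofReal s := by
  let i₀ : Fin d := ⟨0, hd⟩
  have hon : Orthonormal ℝ (({i₀} : Set (Fin d)).domRestrict fun _ => v) := by
    constructor
    · intro i
      exact hv
    · intro i j hij
      exact absurd (Subsingleton.elim i j) hij
  obtain ⟨b, hb⟩ := hon.exists_orthonormalBasis_extension_of_card_eq (by simp)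
  have hb0 : b i₀ = v := hb i₀ rfl
  let l : Fin d → ℝ := fun i => if i = i₀ then c else -(1 / 2)
  let u : Fin d → ℝ := fun i => if i = i₀ then c + s else 1 / 2
  have hmp : MeasurePreserving (fun x : EuclideanSpace ℝ (Fin d) => WithLp.ofLp (b.repr x))
      volume volume :=
    (PiLp.volume_preserving_ofLp (Fin d)).comp b.measurePreserving_repr
  have hsub : {x | x ∈ K ∧ ⟪v, x⟫_ℝ ∈ Set.Icc c (c + s)} ⊆
      (fun x : EuclideanSpace ℝ (Fin d) => WithLp.ofLp (b.repr x)) ⁻¹' Set.Icc l u := by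
    rintro x ⟨hxK, hx⟩
    have hn : ‖x‖ < 1 / 2 := by simpa using hK12 hxK
    have key : ∀ i, l i ≤ b.repr x i ∧ b.repr x i ≤ u i := by
      intro i
      rw [b.repr_apply_apply]
      by_cases hi : i = i₀
      · subst hi
        simpa [l, u, hb0] using hx
      · have h1 : |⟪b i, x⟫_ℝ| ≤ ‖x‖ := by
          simpa using abs_real_inner_le_norm (b i) x
        have h2 := abs_le.1 (h1.trans hn.le)
        simpa [l, u, hi] using h2
    exact ⟨fun i => (key i).1, fun i => (key i).2⟩
  calc
    _ ≤ volume ((fun x : EuclideanSpace ℝ (Fin d) => WithLp.ofLp (b.repr x)) ⁻¹' Set.Icc l u) :=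
      measure_mono hsub
    _ = volume (Set.Icc l u) := hmp.measure_preimage measurableSet_Icc.nullMeasurableSet
    _ = ENNReal.ofReal s := by
      rw [Real.volume_Icc_pi, Finset.prod_eq_single i₀]
      · simp [l, u]
      · intro i _ hi
        simp [l, u, hi]
        norm_num
      · simp

/-- A ray starting in a bounded open set meets the frontier. -/
lemma exists_pos_add_smul_mem_frontier {E : Type*} [NormedAddCommGroup E] [NormedSpace ℝ E]
    {K : Set E} (hKopen : IsOpen K) (hKbdd : IsBounded K) {p u : E} (hp : p ∈ K) (hu : u ≠ 0) :
    ∃ t : ℝ, 0 < t ∧ p + t • u ∈ frontier K := by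
  obtain ⟨R, hR⟩ := hKbdd.subset_ball p
  have hRpos : 0 < R := by simpa using (mem_ball.1 (hR hp))
  have hu' : 0 < ‖u‖ := norm_pos_iff.2 hu
  let f : ℝ → E := fun t => p + |t| • u
  have hf : Continuous f := by fun_prop
  obtain ⟨t, ht⟩ : (frontier (f ⁻¹' K)).Nonempty := by
    refine nonempty_frontier_iff.2 ⟨⟨0, by simpa [f] using hp⟩, fun h => ?_⟩
    have h0 : R / ‖u‖ ∈ f ⁻¹' K := h ▸ Set.mem_univ _
    have h1 := mem_ball.1 (hR h0)
    simp only [f, dist_self_add_left, norm_smul, Real.norm_eq_abs, abs_abs] at h1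
    rw [abs_of_pos (div_pos hRpos hu'), div_mul_cancel₀ _ hu'.ne'] at h1
    exact lt_irrefl _ h1
  have hw : f t ∈ frontier K := hf.frontier_preimage_subset K ht
  refine ⟨|t|, abs_pos.2 ?_, hw⟩
  rintro rfl
  rw [hKopen.frontier_eq] at hw
  exact hw.2 (by simpa [f] using hp)

/-- In a subset of the ball of radius `1/2` the Euclidean distance is at most the Hilbert
distance. -/
lemma norm_sub_le_hilbertDist {d : ℕ} {K : Set (EuclideanSpace ℝ (Fin d))}
    (hKopen : IsOpen K) (hKbdd : IsBounded K)
    (hK12 : K ⊆ ball (0 : EuclideanSpace ℝ (Fin d)) (1 / 2))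
    {p q : EuclideanSpace ℝ (Fin d)} (hp : p ∈ K) (hq : q ∈ K) :
    ‖q - p‖ ≤ hilbertDist K p q := by
  apply le_csInf
  · by_cases hpq : p = q
    · exact ⟨0, Or.inl ⟨hpq, rfl⟩⟩
    · obtain ⟨t, ht, hta⟩ := exists_pos_add_smul_mem_frontier hKopen hKbdd hp (sub_ne_zero.2 hpq)
      obtain ⟨s, hs, hsb⟩ := exists_pos_add_smul_mem_frontier hKopen hKbdd hq
        (sub_ne_zero.2 (Ne.symm hpq))
      exact ⟨_, Or.inr ⟨_, _, hta, hsb, ⟨-t, by linarith, by module⟩,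
        ⟨1 + s, by linarith, by module⟩, rfl⟩⟩
  · rintro r (⟨rfl, rfl⟩ | ⟨a, b, ha, hb, ⟨t, ht, rfl⟩, ⟨s, hs, rfl⟩, rfl⟩)
    · simp
    · rcases eq_or_ne p q with rfl | hpq
      · simp
      have hn : 0 < ‖q - p‖ := norm_pos_iff.2 (sub_ne_zero.2 (Ne.symm hpq))
      have hcl : ∀ x ∈ frontier K, ‖x‖ ≤ 1 / 2 := by
        intro x hx
        simpa using closure_ball_subset_closedBall
          (closure_mono hK12 (frontier_subset_closure hx))
      have hab : (s - t) * ‖q - p‖ ≤ 1 := by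
        have h1 := norm_sub_le (p + s • (q - p)) (p + t • (q - p))
        rw [show p + s • (q - p) - (p + t • (q - p)) = (s - t) • (q - p) by module, norm_smul,
          Real.norm_of_nonneg (by linarith)] at h1
        linarith [hcl _ ha, hcl _ hb]
      have e1 : ‖q - (p + t • (q - p))‖ = (1 - t) * ‖q - p‖ := by
        rw [show q - (p + t • (q - p)) = (1 - t) • (q - p) by module, norm_smul,
          Real.norm_of_nonneg (by linarith)]
      have e2 : ‖p - (p + s • (q - p))‖ = s * ‖q - p‖ := by
        rw [show p - (p + s • (q - p)) = -(s • (q - p)) by module, norm_neg, norm_smul,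
          Real.norm_of_nonneg (by linarith)]
      have e3 : ‖p - (p + t • (q - p))‖ = -t * ‖q - p‖ := by
        rw [show p - (p + t • (q - p)) = (-t) • (q - p) by module, norm_smul,
          Real.norm_of_nonneg (by linarith)]
      have e4 : ‖q - (p + s • (q - p))‖ = (s - 1) * ‖q - p‖ := by
        rw [show q - (p + s • (q - p)) = -((s - 1) • (q - p)) by module, norm_neg, norm_smul,
          Real.norm_of_nonneg (by linarith)]
      have ht' : 0 < -t := by linarith
      have ht1 : 0 < 1 - t := by linarith
      have hs0 : 0 < s := by linarith
      have hs1 : 0 < s - 1 := by linarith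
      rw [e1, e2, e3, e4, show (1 - t) * ‖q - p‖ * (s * ‖q - p‖) /
        (-t * ‖q - p‖ * ((s - 1) * ‖q - p‖)) = ((1 - t) / -t) * (s / (s - 1)) by
          field_simp, Real.log_mul (by positivity) (by positivity)]
      have l1 := Real.one_sub_inv_le_log_of_pos (div_pos ht1 ht')
      have l2 := Real.one_sub_inv_le_log_of_pos (div_pos hs0 hs1)
      have m1 : ‖q - p‖ ≤ 1 - ((1 - t) / -t)⁻¹ := by
        rw [show 1 - ((1 - t) / -t)⁻¹ = 1 / (1 - t) by rw [inv_div]; field_simp; ring,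
          le_div_iff₀ ht1]
        nlinarith
      have m2 : ‖q - p‖ ≤ 1 - (s / (s - 1))⁻¹ := by
        rw [show 1 - (s / (s - 1))⁻¹ = 1 / s by rw [inv_div]; field_simp; ring,
          le_div_iff₀ hs0]
        nlinarith
      linarith

lemma halfspaceDepth_le {d : ℕ} (K : Set (EuclideanSpace ℝ (Fin d)))
    (q : EuclideanSpace ℝ (Fin d)) {v : EuclideanSpace ℝ (Fin d)} (hv : ‖v‖ = 1) :
    halfspaceDepth K q ≤
      (volume {z | z ∈ K ∧ 0 ≤ ⟪v, z - q⟫_ℝ}).toReal / (volume K).toReal :=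
  ciInf_le (f := fun v : {v : EuclideanSpace ℝ (Fin d) // ‖v‖ = 1} =>
      (volume {z | z ∈ K ∧ 0 ≤ ⟪(v : EuclideanSpace ℝ (Fin d)), z - q⟫_ℝ}).toReal
        / (volume K).toReal)
    ⟨0, by rintro _ ⟨v, rfl⟩; positivity⟩ ⟨v, hv⟩

/-- A point of positive halfspace depth in an open convex set belongs to it. -/
lemma mem_of_halfspaceDepth_pos {d : ℕ} {K : Set (EuclideanSpace ℝ (Fin d))}
    (hKne : K.Nonempty) (hKopen : IsOpen K) (hKconv : Convex ℝ K)
    {q : EuclideanSpace ℝ (Fin d)} (hq : 0 < halfspaceDepth K q) : q ∈ K := by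
  by_contra hqK
  obtain ⟨f, hf⟩ := geometric_hahn_banach_open_point hKconv hKopen hqK
  let w := (InnerProductSpace.toDual ℝ (EuclideanSpace ℝ (Fin d))).symm f
  have hw : ∀ x, ⟪w, x⟫_ℝ = f x := fun x => InnerProductSpace.toDual_symm_apply
  have hw0 : w ≠ 0 := by
    intro h
    obtain ⟨x, hx⟩ := hKne
    have h1 := hf x hx
    rw [← hw, ← hw, h] at h1
    simp at h1
  have hn : 0 < ‖w‖ := norm_pos_iff.2 hw0
  have h1 := halfspaceDepth_le K q (v := ‖w‖⁻¹ • w) (by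
    rw [norm_smul, norm_inv, norm_norm, inv_mul_cancel₀ hn.ne'])
  have h2 : {z | z ∈ K ∧ 0 ≤ ⟪‖w‖⁻¹ • w, z - q⟫_ℝ} = ∅ := by
    rw [Set.eq_empty_iff_forall_notMem]
    rintro x ⟨hx, hx0⟩
    rw [real_inner_smul_left, inner_sub_right, hw, hw] at hx0
    have := nonneg_of_mul_nonneg_right hx0 (inv_pos.2 hn)
    linarith [hf x hx]
  rw [h2] at h1
  simp at h1
  linarith

theorem stmt7 {d : ℕ} (hd : 1 ≤ d) (K : Set (EuclideanSpace ℝ (Fin d)))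
    (hKne : K.Nonempty) (hKopen : IsOpen K) (hKbdd : IsBounded K) (hKconv : Convex ℝ K)
    (hK12 : K ⊆ ball (0 : EuclideanSpace ℝ (Fin d)) (1 / 2))
    (δ : ℝ) (hδ0 : 0 < δ) (hδ1 : δ ≤ 1 / 2)
    (ε : ℝ) (hε0 : 0 < ε) (hε1 : ε < 1)
    (z : EuclideanSpace ℝ (Fin d)) (hz : z ∈ depthRegion K δ) :
    hilbertBall K z (ε * δ * (volume K).toReal / 2) ⊆ depthRegion K ((1 - ε) * δ) := by
  have hzK : z ∈ K := mem_of_halfspaceDepth_pos hKne hKopen hKconv (hδ0.trans_le hz)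
  rintro y ⟨-, hyK, hyd⟩
  have hdist : ‖y - z‖ < ε * δ * (volume K).toReal / 2 :=
    (norm_sub_le_hilbertDist hKopen hKbdd hK12 hzK hyK).trans_lt hyd
  have hfin : volume K ≠ ⊤ := hKbdd.measure_lt_top.ne
  have hVpos : 0 < (volume K).toReal :=
    ENNReal.toReal_pos (hKopen.measure_pos volume hKne).ne' hfin
  have : Nonempty {v : EuclideanSpace ℝ (Fin d) // ‖v‖ = 1} :=
    ⟨⟨EuclideanSpace.single ⟨0, hd⟩ 1, by simp⟩⟩
  change (1 - ε) * δ ≤ halfspaceDepth K y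
  rw [halfspaceDepth]
  refine le_ciInf fun ⟨v, hv⟩ => ?_
  have hzv : δ * (volume K).toReal ≤
      (volume {x | x ∈ K ∧ 0 ≤ ⟪v, x - z⟫_ℝ}).toReal :=
    (le_div_iff₀ hVpos).1 (le_trans hz (halfspaceDepth_le K z hv))
  have hsub : {x | x ∈ K ∧ 0 ≤ ⟪v, x - z⟫_ℝ} ⊆ {x | x ∈ K ∧ 0 ≤ ⟪v, x - y⟫_ℝ} ∪
      {x | x ∈ K ∧ ⟪v, x⟫_ℝ ∈ Set.Icc ⟪v, z⟫_ℝ (⟪v, z⟫_ℝ + ‖y - z‖)} := by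
    rintro x ⟨hx, hxz⟩
    have hyz : ⟪v, y - z⟫_ℝ ≤ ‖y - z‖ := by simpa [hv] using real_inner_le_norm v (y - z)
    by_cases hxy : 0 ≤ ⟪v, x - y⟫_ℝ
    · exact Or.inl ⟨hx, hxy⟩
    · rw [inner_sub_right] at hxz hxy hyz
      exact Or.inr ⟨hx, by linarith, by linarith⟩
  have hle : (volume {x | x ∈ K ∧ 0 ≤ ⟪v, x - z⟫_ℝ}).toReal ≤
      (volume {x | x ∈ K ∧ 0 ≤ ⟪v, x - y⟫_ℝ}).toReal + ‖y - z‖ := by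
    have hA : volume {x | x ∈ K ∧ 0 ≤ ⟪v, x - y⟫_ℝ} ≠ ⊤ :=
      measure_ne_top_of_subset (fun _ h => h.1) hfin
    have h := (measure_mono hsub).trans <| (measure_union_le (μ := volume) _ _).trans <|
      add_le_add_right (volume_slab_le hd hK12 hv ⟪v, z⟫_ℝ ‖y - z‖) _
    have h' := ENNReal.toReal_mono (ENNReal.add_ne_top.2 ⟨hA, ENNReal.ofReal_ne_top⟩) h
    rwa [ENNReal.toReal_add hA ENNReal.ofReal_ne_top,
      ENNReal.toReal_ofReal (norm_nonneg _)] at h'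
  rw [le_div_iff₀ hVpos]
  have : 0 < ε * δ * (volume K).toReal := by positivity
  linarith
end

section
/- Let d ≥ 1, let K ⊂ ℝ^d be an open convex body, and let δ ∈ (0,1/2] be such that K_δ ≠ ∅. Then K_δ is a compact, strictly convex set; in particular, for any two distinct points x, y ∈ K_δ, the open segment between x and y is contained in the interior of K_δ. -/
open MeasureTheory Metric Bornology
open scoped InnerProductSpace Pointwise

section HalfspaceCaps

variable {d : ℕ}

lemma volume_hyperplane {v : EuclideanSpace ℝ (Fin d)} (hv : v ≠ 0)
    (q : EuclideanSpace ℝ (Fin d)) :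
    volume {z : EuclideanSpace ℝ (Fin d) | ⟪v, z - q⟫_ℝ = 0} = 0 := by
  have hset : {z : EuclideanSpace ℝ (Fin d) | ⟪v, z - q⟫_ℝ = 0}
      = (AffineSubspace.mk' q (ℝ ∙ v)ᗮ : Set (EuclideanSpace ℝ (Fin d))) := by
    ext z
    simp [AffineSubspace.mem_mk', Submodule.mem_orthogonal_singleton_iff_inner_right]
  rw [hset]
  refine Measure.addHaar_affineSubspace _ _ fun htop => ?_
  have hmem : q + v ∈ AffineSubspace.mk' q (ℝ ∙ v)ᗮ := htop ▸ AffineSubspace.mem_top ℝ _ _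
  simp [AffineSubspace.mem_mk', Submodule.mem_orthogonal_singleton_iff_inner_right, hv] at hmem

/-- The closed halfspace with inner normal `v` whose boundary passes through `q`. -/
def closedHalfspace (v q : EuclideanSpace ℝ (Fin d)) : Set (EuclideanSpace ℝ (Fin d)) :=
  {z | 0 ≤ ⟪v, z - q⟫_ℝ}

lemma mem_closedHalfspace {v q z : EuclideanSpace ℝ (Fin d)} :
    z ∈ closedHalfspace v q ↔ 0 ≤ ⟪v, z - q⟫_ℝ := Iff.rfl

lemma measurableSet_closedHalfspace (v q : EuclideanSpace ℝ (Fin d)) :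
    MeasurableSet (closedHalfspace v q) :=
  measurableSet_le (by fun_prop) (by fun_prop)

lemma closedHalfspace_smul {c : ℝ} (hc : 0 < c) (v q : EuclideanSpace ℝ (Fin d)) :
    closedHalfspace (c • v) q = closedHalfspace v q := by
  ext z
  simp [mem_closedHalfspace, inner_smul_left, hc]

lemma closedHalfspace_subset {v p q : EuclideanSpace ℝ (Fin d)} (h : ⟪v, p⟫_ℝ ≤ ⟪v, q⟫_ℝ) :
    closedHalfspace v q ⊆ closedHalfspace v p := by
  intro z hz
  simp only [mem_closedHalfspace, inner_sub_right] at hz ⊢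
  linarith

lemma continuousAt_measureReal_closedHalfspace {K : Set (EuclideanSpace ℝ (Fin d))}
    (hK : volume K ≠ ⊤) {v : EuclideanSpace ℝ (Fin d)} (hv : v ≠ 0)
    (q : EuclideanSpace ℝ (Fin d)) :
    ContinuousAt (fun p : EuclideanSpace ℝ (Fin d) × EuclideanSpace ℝ (Fin d) =>
      (volume.restrict K).real (closedHalfspace p.2 p.1)) (q, v) := by
  have : IsFiniteMeasure (volume.restrict K) := isFiniteMeasure_restrict.mpr hK
  refine (ENNReal.tendsto_toReal (measure_ne_top _ _)).comp
    (tendsto_measure_of_ae_tendsto_indicator_of_isFiniteMeasure _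
      (measurableSet_closedHalfspace _ _) (fun p => measurableSet_closedHalfspace _ _) ?_)
  have hnull : ∀ᵐ z ∂(volume.restrict K), ⟪v, z - q⟫_ℝ ≠ 0 :=
    ae_restrict_of_ae (measure_eq_zero_iff_ae_notMem.mp (volume_hyperplane hv q))
  filter_upwards [hnull] with z hz
  have hcont : Continuous fun p : EuclideanSpace ℝ (Fin d) × EuclideanSpace ℝ (Fin d) =>
      ⟪p.2, z - p.1⟫_ℝ := by fun_prop
  rcases lt_or_gt_of_ne hz with h | h
  · filter_upwards [hcont.continuousAt.eventually_lt continuousAt_const h] with p hp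
    simp only [mem_closedHalfspace]
    constructor <;> intro <;> linarith
  · filter_upwards [continuousAt_const.eventually_lt hcont.continuousAt h] with p hp
    simp only [mem_closedHalfspace]
    constructor <;> intro <;> linarith

lemma mem_depthRegion_iff (hd : 1 ≤ d) {K : Set (EuclideanSpace ℝ (Fin d))}
    (hKpos : 0 < volume.real K) {δ : ℝ} {q : EuclideanSpace ℝ (Fin d)} :
    q ∈ depthRegion K δ ↔ ∀ v : EuclideanSpace ℝ (Fin d), ‖v‖ = 1 →
      δ * volume.real K ≤ (volume.restrict K).real (closedHalfspace v q) := by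
  have : Nonempty (Fin d) := ⟨⟨0, hd⟩⟩
  obtain ⟨e, he⟩ := exists_norm_eq (EuclideanSpace ℝ (Fin d)) zero_le_one
  have : Nonempty {v : EuclideanSpace ℝ (Fin d) // ‖v‖ = 1} := ⟨⟨e, he⟩⟩
  have hbdd : BddBelow (Set.range fun v : {v : EuclideanSpace ℝ (Fin d) // ‖v‖ = 1} =>
      (volume {z : EuclideanSpace ℝ (Fin d) |
        z ∈ K ∧ 0 ≤ ⟪(v : EuclideanSpace ℝ (Fin d)), z - q⟫_ℝ}).toReal / (volume K).toReal) := by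
    refine ⟨0, ?_⟩
    rintro _ ⟨v, rfl⟩
    positivity
  have hcap : ∀ v, (volume.restrict K).real (closedHalfspace v q)
      = (volume {z : EuclideanSpace ℝ (Fin d) | z ∈ K ∧ 0 ≤ ⟪v, z - q⟫_ℝ}).toReal := fun v => by
    rw [measureReal_restrict_apply (measurableSet_closedHalfspace v q), Set.inter_comm]
    rfl
  change δ ≤ halfspaceDepth K q ↔ _
  rw [halfspaceDepth, le_ciInf_iff hbdd, Subtype.forall]
  refine forall₂_congr fun v _ => ?_
  rw [hcap]
  exact le_div_iff₀ hKpos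

lemma le_measureReal_closedHalfspace (hd : 1 ≤ d) {K : Set (EuclideanSpace ℝ (Fin d))}
    (hKpos : 0 < volume.real K) {δ : ℝ} {q : EuclideanSpace ℝ (Fin d)}
    (hq : q ∈ depthRegion K δ) {v : EuclideanSpace ℝ (Fin d)} (hv : v ≠ 0) :
    δ * volume.real K ≤ (volume.restrict K).real (closedHalfspace v q) := by
  rw [← closedHalfspace_smul (inv_pos.mpr (norm_pos_iff.mpr hv)) v q]
  exact (mem_depthRegion_iff hd hKpos).mp hq _ (by simp [norm_smul, hv])

lemma depthRegion_subset (hd : 1 ≤ d) {K : Set (EuclideanSpace ℝ (Fin d))}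
    (hKpos : 0 < volume.real K) (hKne : K.Nonempty) (hKopen : IsOpen K) (hKconv : Convex ℝ K)
    {δ : ℝ} (hδ : 0 < δ) : depthRegion K δ ⊆ K := by
  intro q hq
  by_contra hqK
  obtain ⟨f, hf⟩ := geometric_hahn_banach_open_point hKconv hKopen hqK
  obtain ⟨v, rfl⟩ := (InnerProductSpace.toDual ℝ (EuclideanSpace ℝ (Fin d))).surjective f
  simp only [InnerProductSpace.toDual_apply_apply] at hf
  have hv : v ≠ 0 := by
    rintro rfl
    obtain ⟨z, hz⟩ := hKne
    simpa using hf z hz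
  have hle := le_measureReal_closedHalfspace hd hKpos hq hv
  have hempty : closedHalfspace v q ∩ K = ∅ := by
    ext z
    simp only [Set.mem_inter_iff, mem_closedHalfspace, inner_sub_right, Set.mem_empty_iff_false,
      iff_false, not_and]
    intro hz hzK
    linarith [hf z hzK]
  rw [measureReal_restrict_apply (measurableSet_closedHalfspace v q), hempty,
    measureReal_empty] at hle
  nlinarith

lemma measureReal_image_similarity (R : EuclideanSpace ℝ (Fin d) ≃ₗᵢ[ℝ] EuclideanSpace ℝ (Fin d))
    {c : ℝ} (hc : 0 ≤ c) (b x : EuclideanSpace ℝ (Fin d)) (S : Set (EuclideanSpace ℝ (Fin d))) :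
    volume.real ((fun z => b + c • R (z - x)) '' S) = c ^ d * volume.real S := by
  have himage : (fun z => b + c • R (z - x)) '' S
      = (fun z => b + z) '' (c • (R '' ((fun z => z + -x) '' S))) := by
    simp only [← Set.image_smul, Set.image_image, ← sub_eq_add_neg]
  have hR : ∀ T : Set (EuclideanSpace ℝ (Fin d)), volume (R '' T) = volume T := fun T => by
    have := R.measurePreserving.measure_preimage_equiv (f := R.toMeasurableEquiv) (R '' T)
    rw [← this, LinearIsometryEquiv.coe_toMeasurableEquiv, Set.preimage_image_eq T R.injective]
  rw [himage, Measure.real, Set.image_add_left, measure_preimage_add, Measure.addHaar_smul, hR,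
    Set.image_add_right, measure_preimage_add_right, finrank_euclideanSpace_fin,
    abs_of_nonneg (by positivity), ENNReal.toReal_mul, ENNReal.toReal_ofReal (by positivity),
    Measure.real]

/-- The part of `K` gained when the halfspace `0 ≤ ⟪v, z - x⟫` is tilted by `t • u` and by
`-t • u`. -/
def gainedWedge (K : Set (EuclideanSpace ℝ (Fin d))) (x v u : EuclideanSpace ℝ (Fin d)) (t : ℝ) :
    Set (EuclideanSpace ℝ (Fin d)) :=
  {z | z ∈ K ∧ ⟪v, z - x⟫_ℝ < 0 ∧
    (0 < ⟪v, z - x⟫_ℝ + t * ⟪u, z - x⟫_ℝ ∨ 0 < ⟪v, z - x⟫_ℝ - t * ⟪u, z - x⟫_ℝ)}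

/-- The part of `K` lost when the halfspace `0 ≤ ⟪v, z - x⟫` is tilted by `t • u` and by
`-t • u`. -/
def lostWedge (K : Set (EuclideanSpace ℝ (Fin d))) (x v u : EuclideanSpace ℝ (Fin d)) (t : ℝ) :
    Set (EuclideanSpace ℝ (Fin d)) :=
  {z | z ∈ K ∧ 0 ≤ ⟪v, z - x⟫_ℝ ∧
    ¬ (0 < ⟪v, z - x⟫_ℝ + t * ⟪u, z - x⟫_ℝ ∧ 0 < ⟪v, z - x⟫_ℝ - t * ⟪u, z - x⟫_ℝ)}

/-- The part of `K` between the parallel hyperplanes with normal `v + t • u` through `x` and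
`x + u`, when `u` is orthogonal to `v`. -/
def tiltedSlab (K : Set (EuclideanSpace ℝ (Fin d))) (x v u : EuclideanSpace ℝ (Fin d)) (t : ℝ) :
    Set (EuclideanSpace ℝ (Fin d)) :=
  {z | z ∈ K ∧ 0 < ⟪v, z - x⟫_ℝ + t * ⟪u, z - x⟫_ℝ ∧
    ⟪v, z - x⟫_ℝ + t * ⟪u, z - x⟫_ℝ < t * ‖u‖ ^ 2}

section Wedges

variable {K : Set (EuclideanSpace ℝ (Fin d))} {x v u : EuclideanSpace ℝ (Fin d)} {t M η : ℝ}

lemma add_smul_ne_zero (hv : ‖v‖ = 1) (huv : ⟪u, v⟫_ℝ = 0) (k : ℝ) : v + k • u ≠ 0 := by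
  intro h
  have hinner := congrArg (fun w => ⟪w, v⟫_ℝ) h
  simp only [inner_add_left, real_inner_smul_left, real_inner_self_eq_norm_sq, hv, huv,
    inner_zero_left] at hinner
  norm_num at hinner

lemma abs_inner_le_of_mem (hM : ∀ z ∈ K, ‖z - x‖ ≤ M) {z : EuclideanSpace ℝ (Fin d)}
    (hz : z ∈ K) : |⟪u, z - x⟫_ℝ| ≤ ‖u‖ * M :=
  (abs_real_inner_le_norm _ _).trans (mul_le_mul_of_nonneg_left (hM z hz) (norm_nonneg _))

lemma abs_inner_le_of_mem_gainedWedge (hM : ∀ z ∈ K, ‖z - x‖ ≤ M) (ht : 0 < t)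
    {z : EuclideanSpace ℝ (Fin d)} (hz : z ∈ gainedWedge K x v u t) :
    |⟪v, z - x⟫_ℝ| ≤ t * (‖u‖ * M) := by
  obtain ⟨hzK, hs, hr⟩ := hz
  have hr' := abs_le.mp (abs_inner_le_of_mem (u := u) hM hzK)
  have h1 := mul_le_mul_of_nonneg_left hr'.1 ht.le
  have h2 := mul_le_mul_of_nonneg_left hr'.2 ht.le
  rw [abs_of_neg hs]
  rcases hr with hr | hr <;> linarith

lemma measureReal_gainedWedge_le_lostWedge (hK : volume K ≠ ⊤) (hKconv : Convex ℝ K)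
    (hball : ball x η ⊆ K) (hM : ∀ z ∈ K, ‖z - x‖ ≤ M) (hv : ‖v‖ = 1) (huv : ⟪u, v⟫_ℝ = 0)
    (ht : 0 < t) {ε : ℝ} (hε0 : 0 < ε) (hε1 : ε < 1) (hε : 2 * (t * (‖u‖ * M)) < ε * η) :
    (1 - ε) ^ d * volume.real (gainedWedge K x v u t) ≤ volume.real (lostWedge K x v u t) := by
  rw [← measureReal_image_similarity (ℝ ∙ v)ᗮ.reflection (sub_nonneg.mpr hε1.le) x x]
  refine measureReal_mono ?_ (ne_top_of_le_ne_top hK (measure_mono fun z hz => hz.1))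
  rintro _ ⟨z, hz, rfl⟩
  have hs := abs_inner_le_of_mem_gainedWedge hM ht hz
  obtain ⟨hzK, hs0, hr⟩ := hz
  set s := ⟪v, z - x⟫_ℝ with hs_def
  have hrefl : (ℝ ∙ v)ᗮ.reflection (z - x) = (z - x) - (2 * s) • v := by
    rw [Submodule.reflection_orthogonal_apply, Submodule.reflection_singleton_apply, hv]
    simp only [← hs_def, RCLike.ofReal_real_eq_id, id, one_pow, div_one]
    module
  have hvv : ⟪v, v⟫_ℝ = 1 := by rw [real_inner_self_eq_norm_sq, hv, one_pow]
  have hε1' : 0 < 1 - ε := sub_pos.mpr hε1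
  refine ⟨?_, ?_⟩
  · have hp : x - (2 * (1 - ε) * s / ε) • v ∈ K := by
      apply hball
      rw [mem_ball, dist_eq_norm, sub_sub_cancel_left, norm_neg, norm_smul, hv, mul_one,
        Real.norm_eq_abs, abs_div, abs_of_pos hε0, div_lt_iff₀ hε0, abs_mul, abs_of_pos
        (by positivity)]
      nlinarith [abs_nonneg s]
    have hcomb := hKconv hzK hp hε1'.le hε0.le (sub_add_cancel 1 ε)
    convert hcomb using 1
    beta_reduce
    rw [hrefl, smul_sub ε, smul_smul ε, mul_div_cancel₀ _ hε0.ne']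
    module
  · simp only [hrefl, add_sub_cancel_left, inner_smul_right, inner_sub_right _ (z - x), hvv, huv,
      ← hs_def]
    refine ⟨by nlinarith, fun h => ?_⟩
    rcases hr with hr | hr
    · nlinarith [h.2, mul_pos hε1' hr]
    · nlinarith [h.1, mul_pos hε1' hr]

lemma measureReal_gainedWedge_le_tiltedSlab (hK : volume K ≠ ⊤) (hball : ball x η ⊆ K)
    (hM : ∀ z ∈ K, ‖z - x‖ ≤ M) (hv : ‖v‖ = 1) (huv : ⟪u, v⟫_ℝ = 0) (ht : 0 < t)
    (htη : t * ‖u‖ ^ 2 < η) {r : ℝ} (hr0 : 0 < r) (hr : 4 * (r * M) < ‖u‖)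
    (hrη : 2 * (r * M) < η) :
    r ^ d * volume.real (gainedWedge K x v u t) ≤ volume.real (tiltedSlab K x v u t) := by
  rw [← measureReal_image_similarity (LinearIsometryEquiv.refl ℝ _) hr0.le
    (x + (t * ‖u‖ ^ 2 / 2) • v) x]
  refine measureReal_mono ?_ (ne_top_of_le_ne_top hK (measure_mono fun z hz => hz.1))
  rintro _ ⟨z, hz, rfl⟩
  have hs := abs_inner_le_of_mem_gainedWedge hM ht hz
  have hzK := hz.1
  have hr' := abs_inner_le_of_mem (u := u) hM hzK
  have hvv : ⟪v, v⟫_ℝ = 1 := by rw [real_inner_self_eq_norm_sq, hv, one_pow]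
  have hdiff : x + (t * ‖u‖ ^ 2 / 2) • v + r • (z - x) - x
      = (t * ‖u‖ ^ 2 / 2) • v + r • (z - x) := by abel
  refine ⟨hball ?_, ?_⟩
  · simp only [LinearIsometryEquiv.coe_refl, id, mem_ball, dist_eq_norm, hdiff]
    refine (norm_add_le _ _).trans_lt ?_
    rw [norm_smul, norm_smul, hv, Real.norm_of_nonneg (by positivity), Real.norm_of_nonneg hr0.le]
    nlinarith [mul_le_mul_of_nonneg_left (hM z hzK) hr0.le]
  · simp only [LinearIsometryEquiv.coe_refl, id, hdiff, inner_add_right, inner_smul_right, hvv, huv]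
    have hu : 0 < ‖u‖ := by
      have : 0 ≤ M := (norm_nonneg _).trans (hM z hzK)
      exact lt_of_le_of_lt (by positivity) hr
    have hsum : |r * (⟪v, z - x⟫_ℝ + t * ⟪u, z - x⟫_ℝ)| < t * ‖u‖ ^ 2 / 2 := by
      rw [abs_mul, abs_of_pos hr0]
      calc r * |⟪v, z - x⟫_ℝ + t * ⟪u, z - x⟫_ℝ|
          ≤ r * (t * (‖u‖ * M) + t * (‖u‖ * M)) := by
            refine mul_le_mul_of_nonneg_left ((abs_add_le _ _).trans ?_) hr0.le
            rw [abs_mul t, abs_of_pos ht]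
            gcongr
        _ = (t * ‖u‖ / 2) * (4 * (r * M)) := by ring
        _ < (t * ‖u‖ / 2) * ‖u‖ := by gcongr
        _ = t * ‖u‖ ^ 2 / 2 := by ring
    obtain ⟨h1, h2⟩ := abs_lt.mp hsum
    constructor <;> linarith

lemma measureReal_tiltedSlab_pos (hK : volume K ≠ ⊤) (hKopen : IsOpen K) (hball : ball x η ⊆ K)
    (hv : ‖v‖ = 1) (huv : ⟪u, v⟫_ℝ = 0) (hu : u ≠ 0) (ht : 0 < t) (htη : t * ‖u‖ ^ 2 < η) :
    0 < volume.real (tiltedSlab K x v u t) := by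
  have hopen : IsOpen (tiltedSlab K x v u t) :=
    .and hKopen (.and (isOpen_lt (by fun_prop) (by fun_prop))
      (isOpen_lt (by fun_prop) (by fun_prop)))
  have hvv : ⟪v, v⟫_ℝ = 1 := by rw [real_inner_self_eq_norm_sq, hv, one_pow]
  have hpos : 0 < t * ‖u‖ ^ 2 := mul_pos ht (pow_pos (norm_pos_iff.mpr hu) 2)
  refine ENNReal.toReal_pos (hopen.measure_pos volume ⟨x + (t * ‖u‖ ^ 2 / 2) • v, ?_⟩).ne'
    (ne_top_of_le_ne_top hK (measure_mono fun z hz => hz.1))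
  refine ⟨hball ?_, ?_⟩
  · rw [mem_ball, dist_eq_norm, add_sub_cancel_left, norm_smul, hv,
      Real.norm_of_nonneg (by positivity)]
    linarith
  · simp only [add_sub_cancel_left, inner_smul_right, hvv, huv]
    constructor <;> linarith

lemma measureReal_tiltedSlab_add_lostWedge_le (hK : volume K ≠ ⊤)
    (hv : ‖v‖ = 1) (huv : ⟪u, v⟫_ℝ = 0) (htu : 0 < t * ‖u‖ ^ 2)
    (h0 : (volume.restrict K).real (closedHalfspace v x)
      ≤ (volume.restrict K).real (closedHalfspace (v + t • u) (x + u)))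
    (h1 : (volume.restrict K).real (closedHalfspace v x)
      ≤ (volume.restrict K).real (closedHalfspace (v - t • u) x)) :
    volume.real (tiltedSlab K x v u t) + volume.real (lostWedge K x v u t)
      ≤ volume.real (gainedWedge K x v u t) := by
  have : IsFiniteMeasure (volume.restrict K) := isFiniteMeasure_restrict.mpr hK
  set μ := volume.restrict K with hμ
  let A : Set (EuclideanSpace ℝ (Fin d)) := {z | 0 < ⟪v, z - x⟫_ℝ + t * ⟪u, z - x⟫_ℝ}
  let B : Set (EuclideanSpace ℝ (Fin d)) := {z | 0 < ⟪v, z - x⟫_ℝ - t * ⟪u, z - x⟫_ℝ}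
  let P : Set (EuclideanSpace ℝ (Fin d)) :=
    {z | ⟪v, z - x⟫_ℝ + t * ⟪u, z - x⟫_ℝ < t * ‖u‖ ^ 2}
  have hA : MeasurableSet A := measurableSet_lt (by fun_prop) (by fun_prop)
  have hB : MeasurableSet B := measurableSet_lt (by fun_prop) (by fun_prop)
  have hP : MeasurableSet P := measurableSet_lt (by fun_prop) (by fun_prop)
  have hH := measurableSet_closedHalfspace v x
  have hslab : volume.real (tiltedSlab K x v u t) = μ.real (A ∩ P) := by
    rw [hμ, measureReal_restrict_apply (hA.inter hP), Set.inter_comm]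
    rfl
  have hlost : volume.real (lostWedge K x v u t) = μ.real (closedHalfspace v x \ (A ∩ B)) := by
    rw [hμ, measureReal_restrict_apply (hH.diff (hA.inter hB)), Set.inter_comm]
    rfl
  have hgained : volume.real (gainedWedge K x v u t) = μ.real ((A ∪ B) \ closedHalfspace v x) := by
    rw [hμ, measureReal_restrict_apply ((hA.union hB).diff hH)]
    congr 1
    ext z
    simp only [gainedWedge, closedHalfspace, A, B, Set.mem_ofPred_eq, Set.mem_inter_iff,
      Set.mem_sdiff, Set.mem_union, not_le]
    tauto
  have hAP : μ.real (closedHalfspace (v + t • u) (x + u)) + μ.real (A ∩ P) ≤ μ.real A := by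
    rw [add_comm, ← measureReal_inter_add_sdiff (s := A) hP]
    refine add_le_add_right (measureReal_mono fun z hz => ?_) _
    have hsum : ⟪v + t • u, z - (x + u)⟫_ℝ
        = ⟪v, z - x⟫_ℝ + t * ⟪u, z - x⟫_ℝ - t * ‖u‖ ^ 2 := by
      rw [← sub_sub, inner_sub_right, inner_add_left, inner_add_left, real_inner_smul_left,
        real_inner_smul_left, real_inner_self_eq_norm_sq, real_inner_comm u v, huv]
      ring
    rw [mem_closedHalfspace, hsum] at hz
    simp only [A, P, Set.mem_sdiff, Set.mem_ofPred_eq]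
    constructor <;> linarith
  have hB' : μ.real (closedHalfspace (v - t • u) x) ≤ μ.real B := by
    have hw : v - t • u ≠ 0 := by
      simpa [sub_eq_add_neg] using add_smul_ne_zero hv huv (-t)
    have hnull : μ.real {z | ⟪v - t • u, z - x⟫_ℝ = 0} = 0 := by
      rw [Measure.real, Measure.absolutelyContinuous_restrict (volume_hyperplane hw x),
        ENNReal.toReal_zero]
    have hsub : closedHalfspace (v - t • u) x ⊆ B ∪ {z | ⟪v - t • u, z - x⟫_ℝ = 0} := by
      intro z hz
      rcases (mem_closedHalfspace.mp hz).lt_or_eq with h | h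
      · left
        simpa [B, inner_sub_left, inner_smul_left] using h
      · exact Or.inr h.symm
    linarith [measureReal_mono (μ := μ) hsub,
      measureReal_union_le (μ := μ) B {z | ⟪v - t • u, z - x⟫_ℝ = 0}]
  have hAB := measureReal_union_add_inter (μ := μ) (s := A) hB
  have hU := measureReal_inter_add_sdiff (μ := μ) (s := A ∪ B) hH
  have hUH : μ.real ((A ∪ B) ∩ closedHalfspace v x) ≤ μ.real (closedHalfspace v x) :=
    measureReal_mono Set.inter_subset_right
  have hHAB : μ.real (closedHalfspace v x ∩ (A ∩ B)) = μ.real (A ∩ B) := by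
    congr 1
    refine Set.inter_eq_right.mpr fun z hz => ?_
    have h1 : 0 < ⟪v, z - x⟫_ℝ + t * ⟪u, z - x⟫_ℝ := hz.1
    have h2 : 0 < ⟪v, z - x⟫_ℝ - t * ⟪u, z - x⟫_ℝ := hz.2
    rw [mem_closedHalfspace]
    linarith
  have hHdiff := measureReal_inter_add_sdiff (μ := μ) (s := closedHalfspace v x) (hA.inter hB)
  rw [hslab, hlost, hgained]
  linarith

end Wedges

/-- A hyperplane through two distinct points never cuts off exactly the
minimal volume of the halfspaces bounded by hyperplanes through either point: tilting it around
both points would cut off less. -/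
lemma lt_measureReal_closedHalfspace_of_inner_eq {K : Set (EuclideanSpace ℝ (Fin d))}
    (hKopen : IsOpen K) (hKbdd : IsBounded K) (hKconv : Convex ℝ K)
    {x y v : EuclideanSpace ℝ (Fin d)} (hxy : x ≠ y) (hxK : x ∈ K) (hv : ‖v‖ = 1)
    (hvxy : ⟪v, x⟫_ℝ = ⟪v, y⟫_ℝ) {c : ℝ}
    (hx : ∀ w : EuclideanSpace ℝ (Fin d), w ≠ 0 →
      c ≤ (volume.restrict K).real (closedHalfspace w x))
    (hy : ∀ w : EuclideanSpace ℝ (Fin d), w ≠ 0 →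
      c ≤ (volume.restrict K).real (closedHalfspace w y)) :
    c < (volume.restrict K).real (closedHalfspace v x) := by
  by_contra! hle
  have hK : volume K ≠ ⊤ := hKbdd.measure_lt_top.ne
  obtain ⟨η, hη, hball⟩ := Metric.isOpen_iff.mp hKopen x hxK
  obtain ⟨M, hM0, hM⟩ : ∃ M > 0, ∀ z ∈ K, ‖z - x‖ ≤ M := by
    obtain ⟨M, hM0, hsub⟩ := hKbdd.subset_closedBall_lt 0 x
    exact ⟨M, hM0, fun z hz => by simpa [dist_eq_norm] using hsub hz⟩
  obtain ⟨u, rfl⟩ : ∃ u, y = x + u := ⟨y - x, by abel⟩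
  have hu : u ≠ 0 := fun h => hxy (by simp [h])
  have ha : 0 < ‖u‖ := norm_pos_iff.mpr hu
  have huv : ⟪u, v⟫_ℝ = 0 := by
    rw [inner_add_right] at hvxy
    rw [real_inner_comm]
    linarith
  obtain ⟨r, hr0, hr1, hr2⟩ : ∃ r : ℝ, 0 < r ∧ 4 * (r * M) < ‖u‖ ∧ 2 * (r * M) < η := by
    refine ⟨min ‖u‖ η / (8 * M), by positivity, ?_, ?_⟩ <;>
      rw [div_mul_eq_mul_div, mul_div_mul_right _ _ hM0.ne']
    · linarith [min_le_left ‖u‖ η]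
    · linarith [min_le_right ‖u‖ η]
  set C := 3 * (‖u‖ * M) / η with hC
  have hC0 : 0 < C := by positivity
  have hCη : C * η = 3 * (‖u‖ * M) := div_mul_cancel₀ _ hη.ne'
  obtain ⟨t, ht, ht1, ht2, ht3⟩ :
      ∃ t : ℝ, 0 < t ∧ C * t < 1 ∧ t * ‖u‖ ^ 2 < η ∧ d * (C * t) < r ^ d := by
    have hsmall : ∀ k b : ℝ, 0 < b → ∀ᶠ t in nhdsWithin (0 : ℝ) (Set.Ioi 0), k * t < b :=
      fun k b hb => nhdsWithin_le_nhds
        ((continuous_const.mul continuous_id).continuousAt.eventually_lt continuousAt_const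
          (by simpa using hb))
    obtain ⟨t, h1, h2, h3, h4⟩ := ((hsmall C 1 one_pos).and ((hsmall (‖u‖ ^ 2) η hη).and
      ((hsmall (d * C) (r ^ d) (by positivity)).and self_mem_nhdsWithin))).exists
    exact ⟨t, h4, h1, by linarith, by linarith⟩
  have hbalance := measureReal_tiltedSlab_add_lostWedge_le (t := t) hK hv huv (by positivity)
    (hle.trans (hy _ (add_smul_ne_zero hv huv t)))
    (hle.trans (hx _ (by simpa [sub_eq_add_neg] using add_smul_ne_zero hv huv (-t))))
  have hlost := measureReal_gainedWedge_le_lostWedge hK hKconv hball hM hv huv ht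
    (mul_pos hC0 ht) ht1 (by nlinarith [mul_pos ht (mul_pos ha hM0)])
  have hslab := measureReal_gainedWedge_le_tiltedSlab hK hball hM hv huv ht ht2 hr0 hr1 hr2
  have hpos := measureReal_tiltedSlab_pos hK hKopen hball hv huv hu ht ht2
  have hbern := one_add_mul_le_pow (show -2 ≤ -(C * t) by linarith) d
  rw [← sub_eq_add_neg] at hbern
  have hlost0 : 0 ≤ volume.real (lostWedge K x v u t) := measureReal_nonneg
  have hgpos : 0 < volume.real (gainedWedge K x v u t) := by linarith
  nlinarith [mul_le_mul_of_nonneg_right hbern hgpos.le, mul_lt_mul_of_pos_right ht3 hgpos]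

lemma lt_measureReal_closedHalfspace_of_inner_lt {K : Set (EuclideanSpace ℝ (Fin d))}
    (hKopen : IsOpen K) (hKbdd : IsBounded K) (hKconv : Convex ℝ K)
    {x m v : EuclideanSpace ℝ (Fin d)} (hxK : x ∈ K) (hmK : m ∈ K)
    (hlt : ⟪v, m⟫_ℝ < ⟪v, x⟫_ℝ) :
    (volume.restrict K).real (closedHalfspace v x)
      < (volume.restrict K).real (closedHalfspace v m) := by
  have : IsFiniteMeasure (volume.restrict K) :=
    isFiniteMeasure_restrict.mpr hKbdd.measure_lt_top.ne
  let W : Set (EuclideanSpace ℝ (Fin d)) := {z | ⟪v, m⟫_ℝ < ⟪v, z⟫_ℝ ∧ ⟪v, z⟫_ℝ < ⟪v, x⟫_ℝ}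
  have hW : IsOpen W :=
    .and (isOpen_lt (by fun_prop) (by fun_prop)) (isOpen_lt (by fun_prop) (by fun_prop))
  have hWpos : 0 < (volume.restrict K).real W := by
    refine ENNReal.toReal_pos ?_ (measure_ne_top _ _)
    rw [Measure.restrict_apply hW.measurableSet]
    refine ((hW.inter hKopen).measure_pos volume ⟨(1 / 2 : ℝ) • m + (1 / 2 : ℝ) • x, ?_, ?_⟩).ne'
    · simp only [W, Set.mem_ofPred_eq, inner_add_right, inner_smul_right]
      constructor <;> linarith
    · exact hKconv hmK hxK (by norm_num) (by norm_num) (by norm_num)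
  have hdisj : Disjoint (closedHalfspace v x) W := by
    refine Set.disjoint_left.mpr fun z hz hzW => ?_
    rw [mem_closedHalfspace, inner_sub_right] at hz
    linarith [hzW.2]
  have hsub : closedHalfspace v x ∪ W ⊆ closedHalfspace v m := by
    refine Set.union_subset (closedHalfspace_subset hlt.le) fun z hz => ?_
    rw [mem_closedHalfspace, inner_sub_right]
    linarith [hz.1]
  have hunion := measureReal_union (μ := volume.restrict K) hdisj hW.measurableSet
  linarith [measureReal_mono (μ := volume.restrict K) hsub]

end HalfspaceCaps

theorem stmt11 {d : ℕ} (hd : 1 ≤ d) (K : Set (EuclideanSpace ℝ (Fin d)))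
    (hKne : K.Nonempty) (hKopen : IsOpen K) (hKbdd : IsBounded K) (hKconv : Convex ℝ K)
    (δ : ℝ) (hδ0 : 0 < δ) (hδ1 : δ ≤ 1 / 2)
    (hne : (depthRegion K δ).Nonempty) :
    IsCompact (depthRegion K δ) ∧ Convex ℝ (depthRegion K δ) ∧
      ∀ x ∈ depthRegion K δ, ∀ y ∈ depthRegion K δ, x ≠ y →
        openSegment ℝ x y ⊆ interior (depthRegion K δ) := by
  have hKfin : volume K ≠ ⊤ := hKbdd.measure_lt_top.ne
  have hKpos : 0 < volume.real K :=
    ENNReal.toReal_pos (hKopen.measure_pos volume hKne).ne' hKfin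
  have hfin : IsFiniteMeasure (volume.restrict K) := isFiniteMeasure_restrict.mpr hKfin
  have hsub : depthRegion K δ ⊆ K := depthRegion_subset hd hKpos hKne hKopen hKconv hδ0
  have hconv : Convex ℝ (depthRegion K δ) := by
    intro x hx y hy a b ha hb hab
    refine (mem_depthRegion_iff hd hKpos).mpr fun v hv => ?_
    have hx' := (mem_depthRegion_iff hd hKpos).mp hx v hv
    have hy' := (mem_depthRegion_iff hd hKpos).mp hy v hv
    have hinner : ⟪v, a • x + b • y⟫_ℝ = a * ⟪v, x⟫_ℝ + b * ⟪v, y⟫_ℝ := by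
      simp only [inner_add_right, inner_smul_right]
    obtain rfl : a = 1 - b := by linarith
    rcases le_total ⟪v, x⟫_ℝ ⟪v, y⟫_ℝ with h | h
    · exact hy'.trans (measureReal_mono (closedHalfspace_subset (by rw [hinner]; nlinarith)))
    · exact hx'.trans (measureReal_mono (closedHalfspace_subset (by rw [hinner]; nlinarith)))
  refine ⟨isCompact_of_isClosed_isBounded ?_ (hKbdd.subset hsub), hconv, ?_⟩
  · have hInter : depthRegion K δ = ⋂ v : EuclideanSpace ℝ (Fin d), ⋂ _ : ‖v‖ = 1,
        {q | δ * volume.real K ≤ (volume.restrict K).real (closedHalfspace v q)} := by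
      ext q
      simp only [mem_depthRegion_iff hd hKpos, Set.mem_iInter, Set.mem_ofPred_eq]
    rw [hInter]
    refine isClosed_iInter fun v => isClosed_iInter fun hv => isClosed_le continuous_const ?_
    refine continuous_iff_continuousAt.mpr fun q => ?_
    have hv0 : v ≠ 0 := norm_ne_zero_iff.mp (by rw [hv]; exact one_ne_zero)
    exact (continuousAt_measureReal_closedHalfspace hKfin hv0 q).comp
      (f := fun q => (q, v)) (by fun_prop)
  · rintro x hx y hy hxy m hm
    have hmK : m ∈ K := hsub (hconv.openSegment_subset hx hy hm)
    obtain ⟨a, b, ha, hb, hab, rfl⟩ := hm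
    have hstrict : ∀ v ∈ sphere (0 : EuclideanSpace ℝ (Fin d)) 1,
        δ * volume.real K < (volume.restrict K).real (closedHalfspace v (a • x + b • y)) := by
      intro v hv
      rw [mem_sphere_zero_iff_norm] at hv
      have hinner : ⟪v, a • x + b • y⟫_ℝ = a * ⟪v, x⟫_ℝ + b * ⟪v, y⟫_ℝ := by
        simp only [inner_add_right, inner_smul_right]
      have hx' := (mem_depthRegion_iff hd hKpos).mp hx v hv
      have hy' := (mem_depthRegion_iff hd hKpos).mp hy v hv
      obtain rfl : a = 1 - b := by linarith
      rcases lt_trichotomy ⟪v, x⟫_ℝ ⟪v, y⟫_ℝ with h | h | h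
      · exact hy'.trans_lt (lt_measureReal_closedHalfspace_of_inner_lt hKopen hKbdd hKconv
          (hsub hy) hmK (by rw [hinner]; nlinarith))
      · refine (lt_measureReal_closedHalfspace_of_inner_eq hKopen hKbdd hKconv hxy (hsub hx) hv h
          (fun w hw => le_measureReal_closedHalfspace hd hKpos hx hw)
          (fun w hw => le_measureReal_closedHalfspace hd hKpos hy hw)).trans_le
          (measureReal_mono (closedHalfspace_subset ?_))
        rw [hinner, ← h]
        linarith
      · exact hx'.trans_lt (lt_measureReal_closedHalfspace_of_inner_lt hKopen hKbdd hKconv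
          (hsub hx) hmK (by rw [hinner]; nlinarith))
    have hnear := (isCompact_sphere (0 : EuclideanSpace ℝ (Fin d)) 1)
      |>.eventually_forall_of_forall_eventually
        (P := fun q v => δ * volume.real K < (volume.restrict K).real (closedHalfspace v q))
        fun v hv => continuousAt_const.eventually_lt
          (continuousAt_measureReal_closedHalfspace hKfin (ne_zero_of_mem_unit_sphere ⟨v, hv⟩) _)
          (hstrict v hv)
    refine mem_interior_iff_mem_nhds.mpr ?_
    filter_upwards [hnear] with q hq
    exact (mem_depthRegion_iff hd hKpos).mpr fun v hv =>
      (hq v (mem_sphere_zero_iff_norm.mpr hv)).le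
end
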